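/- arXiv:1810.13316 — 2 statements merged into one kernel-verified Lean document; each statement's English description precedes it below -/
import Mathlib

section
/- Let W be the set of ordinals below ω^ω with its natural well-order. For every natural number k and every colouring c : W × W → {0,1}, either there exist subsets C, D ⊆ W, each of order type ω^ω, with c constantly 0 on C × D, or there exist C, D ⊆ W with |C| = |D| = k and c constantly 1 on C × D. -/
open Ordinal

namespace PolarAux

open Filter

/-- Well-founded trees with `ω`-branching nodes and labelled leaves. -/
inductive Tr (A : Type*) : Type _
  | leaf (a : A) : Tr A
  | node (ch : ℕ → Tr A) : Tr A

namespace Tr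

variable {A : Type*}

/-- The iterated ultrafilter on leaves attached to a tree. -/
noncomputable def U : Tr A → Ultrafilter A
  | leaf a => pure a
  | node ch => Ultrafilter.bind (hyperfilter ℕ) (fun i => U (ch i))

/-- Children; a leaf is its own child. -/
def child : Tr A → ℕ → Tr A
  | leaf a, _ => leaf a
  | node ch, i => ch i

/-- All inner nodes carry non-principal ultrafilters. -/
def Good : Tr A → Prop
  | leaf _ => True
  | node ch => (∀ i, Good (ch i)) ∧ ∀ a, ∀ᶠ x in (U (node ch) : Filter A), x ≠ a

/-- `C` contains the leaves of an everywhere infinitely branching subtree. -/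
def Large (C : Set A) : Tr A → Prop
  | leaf a => a ∈ C
  | node ch => ∃ᶠ i in atTop, Large C (ch i)

theorem ev_leaf (a : A) (p : A → Prop) : (∀ᶠ x in (U (leaf a) : Filter A), p x) ↔ p a := by
  simp [U]

theorem ev_node (ch : ℕ → Tr A) (p : A → Prop) :
    (∀ᶠ x in (U (node ch) : Filter A), p x) ↔
      ∀ᶠ i in (hyperfilter ℕ : Filter ℕ), ∀ᶠ x in (U (ch i) : Filter A), p x := by
  rw [U]
  exact Iff.rfl

theorem Good.child {t : Tr A} (h : t.Good) (i : ℕ) : (t.child i).Good := by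
  cases t with
  | leaf a => exact h
  | node ch => exact h.1 i

end Tr

open Tr

variable {A B : Type*}

theorem exists_finset_of_nonprincipal (V : Ultrafilter A) (hV : ∀ a, ∀ᶠ x in (V : Filter A), x ≠ a)
    (p : A → Prop) (hp : ∀ᶠ x in (V : Filter A), p x) (k : ℕ) :
    ∃ F : Finset A, F.card = k ∧ ∀ x ∈ F, p x := by
  have hinf : {x | p x}.Infinite := by
    intro hfin
    have h1 : ∀ᶠ x in (V : Filter A), ∀ a ∈ {x | p x}, x ≠ a :=
      (Filter.eventually_all_finite hfin).2 (fun a _ => hV a)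
    obtain ⟨x, hx, hx'⟩ := (h1.and hp).exists
    exact hx x hx' rfl
  obtain ⟨F, hF, hc⟩ := hinf.exists_subset_card_eq k
  exact ⟨F, hc, fun x hx => hF hx⟩

/-- Compatibility. -/
def Bc (E : A → B → Prop) (s : Tr A) (t : Tr B) : Prop :=
  ∀ᶠ x in (U s : Filter A), ∀ᶠ y in (U t : Filter B), ¬ E x y

theorem Bc_of_free (E : A → B → Prop) (k : ℕ)
    (hE : ¬ ∃ (F : Finset A) (G : Finset B), F.card = k ∧ G.card = k ∧ ∀ x ∈ F, ∀ y ∈ G, E x y)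
    (V : Ultrafilter A) (V' : Ultrafilter B) (hV : ∀ a, ∀ᶠ x in (V : Filter A), x ≠ a)
    (hV' : ∀ a, ∀ᶠ x in (V' : Filter B), x ≠ a) :
    ∀ᶠ x in (V : Filter A), ∀ᶠ y in (V' : Filter B), ¬ E x y := by
  by_contra hcon
  rw [← Ultrafilter.eventually_not] at hcon
  obtain ⟨F, hF, hF'⟩ := exists_finset_of_nonprincipal V hV _ hcon k
  have h2 : ∀ᶠ y in (V' : Filter B), ∀ x ∈ F, E x y := by
    rw [Filter.eventually_all_finset]
    intro x hx
    have := hF' x hx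
    rw [← Ultrafilter.eventually_not] at this
    simpa using this
  obtain ⟨G, hG, hG'⟩ := exists_finset_of_nonprincipal V' hV' _ h2 k
  exact hE ⟨F, G, hF, hG, fun x hx y hy => hG' y hy x hx⟩

theorem Bc_comm (E : A → B → Prop) (k : ℕ)
    (hE : ¬ ∃ (F : Finset A) (G : Finset B), F.card = k ∧ G.card = k ∧ ∀ x ∈ F, ∀ y ∈ G, E x y)
    (s : Tr A) (t : Tr B) (hs : s.Good) (ht : t.Good) :
    Bc E s t ↔ Bc (fun y x => E x y) t s := by
  cases s with
  | leaf a => simp only [Bc, ev_leaf]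
  | node ch =>
    cases t with
    | leaf b => simp only [Bc, ev_leaf]
    | node ch' =>
      refine iff_of_true (Bc_of_free E k hE _ _ hs.2 ht.2) (Bc_of_free _ k ?_ _ _ ht.2 hs.2)
      rintro ⟨F, G, hF, hG, h⟩
      exact hE ⟨G, F, hG, hF, fun x hx y hy => h y hy x hx⟩

theorem Bc_child (E : A → B → Prop) (s : Tr A) (t : Tr B) (h : Bc E s t) :
    ∀ᶠ i in (hyperfilter ℕ : Filter ℕ), Bc E (s.child i) t := by
  cases s with
  | leaf a => exact Filter.Eventually.of_forall (fun _ => h)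
  | node ch => exact (ev_node ch _).1 h

section closure

variable {X : Type*} (R : X → X → Prop) (ch : X → ℕ → X)

theorem closure_one (symm : ∀ x y, R x y → R y x) (hrefl : ∀ x, R x x → ∀ i, R (ch x i) (ch x i))
    (hext : ∀ x y, R x y → ∀ᶠ i in (hyperfilter ℕ : Filter ℕ), R (ch x i) y)
    (n : ℕ) (P : Set X) (hP : P.Finite) (hR : ∀ x ∈ P, ∀ y ∈ P, R x y)
    (Q : Set X) (hQ : Q.Finite) (hQP : Q ⊆ P) :
    ∃ P' : Set X, P'.Finite ∧ (∀ x ∈ P', ∀ y ∈ P', R x y) ∧ P ⊆ P' ∧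
      ∀ x ∈ Q, ∃ i ≥ n, ch x i ∈ P' := by
  induction Q, hQ using Set.Finite.induction_on with
  | empty => exact ⟨P, hP, hR, subset_rfl, by simp⟩
  | @insert a S _ _ ih =>
    obtain ⟨P', hf, hR', hPP', hS⟩ := ih (fun x hx => hQP (Set.mem_insert_of_mem _ hx))
    have haP : a ∈ P' := hPP' (hQP (Set.mem_insert _ _))
    have h1 : ∀ᶠ i in (hyperfilter ℕ : Filter ℕ), ∀ y ∈ P', R (ch a i) y :=
      (Filter.eventually_all_finite hf).2 (fun y hy => hext a y (hR' a haP y hy))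
    have h2 : ∀ᶠ i in (hyperfilter ℕ : Filter ℕ), n ≤ i := by
      have := Filter.eventually_ge_atTop n
      rw [← Nat.cofinite_eq_atTop] at this
      exact hyperfilter_le_cofinite this
    obtain ⟨i, hi, hni⟩ := (h1.and h2).exists
    refine ⟨insert (ch a i) P', hf.insert _, ?_, hPP'.trans (Set.subset_insert _ _), ?_⟩
    · rintro x (rfl | hx) y (rfl | hy)
      · exact hrefl a (hR' a haP a haP) i
      · exact hi y hy
      · exact symm _ _ (hi x hx)
      · exact hR' x hx y hy
    · rintro x (rfl | hx)
      · exact ⟨i, hni, Set.mem_insert _ _⟩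
      · obtain ⟨j, hj, hj'⟩ := hS x hx
        exact ⟨j, hj, Set.mem_insert_of_mem _ hj'⟩

theorem closure_all (symm : ∀ x y, R x y → R y x) (hrefl : ∀ x, R x x → ∀ i, R (ch x i) (ch x i))
    (hext : ∀ x y, R x y → ∀ᶠ i in (hyperfilter ℕ : Filter ℕ), R (ch x i) y)
    (P : Set X) (hP : P.Finite) (hR : ∀ x ∈ P, ∀ y ∈ P, R x y) :
    ∃ P' : Set X, (∀ x ∈ P', ∀ y ∈ P', R x y) ∧ P ⊆ P' ∧
      ∀ x ∈ P', ∃ᶠ i in atTop, ch x i ∈ P' := by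
  let St := {P : Set X // P.Finite ∧ ∀ x ∈ P, ∀ y ∈ P, R x y}
  have step : ∀ (n : ℕ) (p : St), ∃ q : St, p.1 ⊆ q.1 ∧ ∀ x ∈ p.1, ∃ i ≥ n, ch x i ∈ q.1 := by
    rintro n ⟨p, hp, hp'⟩
    obtain ⟨P', h1, h2, h3, h4⟩ :=
      closure_one R ch symm hrefl hext n p hp hp' p hp subset_rfl
    exact ⟨⟨P', h1, h2⟩, h3, h4⟩
  choose F hF1 hF2 using step
  let S : ℕ → St := fun n => Nat.rec ⟨P, hP, hR⟩ (fun n p => F n p) n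
  have hmono : Monotone (fun n => (S n).1) := monotone_nat_of_le_succ (fun n => hF1 n (S n))
  refine ⟨⋃ n, (S n).1, ?_, fun x hx => Set.mem_iUnion.2 ⟨0, hx⟩, ?_⟩
  · intro x hx y hy
    obtain ⟨n, hn⟩ := Set.mem_iUnion.1 hx
    obtain ⟨m, hm⟩ := Set.mem_iUnion.1 hy
    exact (S (max n m)).2.2 x (hmono (le_max_left _ _) hn) y (hmono (le_max_right _ _) hm)
  · intro x hx
    obtain ⟨n, hn⟩ := Set.mem_iUnion.1 hx
    rw [Filter.frequently_atTop]
    intro N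
    obtain ⟨i, hi, hi'⟩ := hF2 (max n N) (S (max n N)) x (hmono (le_max_left _ _) hn)
    exact ⟨i, (le_max_right _ _).trans hi, Set.mem_iUnion.2 ⟨max n N + 1, hi'⟩⟩

end closure

/-- Compatibility on the disjoint union of both trees. -/
def RR (E : A → B → Prop) : Tr A ⊕ Tr B → Tr A ⊕ Tr B → Prop
  | .inl s, .inl s' => s.Good ∧ s'.Good
  | .inl s, .inr t => s.Good ∧ t.Good ∧ Bc E s t
  | .inr t, .inl s => s.Good ∧ t.Good ∧ Bc E s t
  | .inr t, .inr t' => t.Good ∧ t'.Good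

theorem large_of_closed (P : Set (Tr A)) (h : ∀ s ∈ P, ∃ᶠ i in atTop, s.child i ∈ P)
    (s : Tr A) (hs : s ∈ P) : Large {a | Tr.leaf a ∈ P} s := by
  induction s with
  | leaf a => exact hs
  | node ch ih => exact (h _ hs).mono (fun i hi => ih i hi)

theorem main_tree (E : A → B → Prop) (k : ℕ)
    (hE : ¬ ∃ (F : Finset A) (G : Finset B), F.card = k ∧ G.card = k ∧ ∀ x ∈ F, ∀ y ∈ G, E x y)
    (s : Tr A) (t : Tr B) (hs : s.Good) (ht : t.Good) (hst : Bc E s t) :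
    ∃ (C : Set A) (D : Set B), Large C s ∧ Large D t ∧ ∀ x ∈ C, ∀ y ∈ D, ¬ E x y := by
  obtain ⟨P, hP, hsub, hcl⟩ := closure_all (RR E)
    (fun x i => Sum.map (fun s => s.child i) (fun t => t.child i) x)
    (by rintro (x | x) (y | y) h <;> simp only [RR] at h ⊢ <;> tauto)
    (by
      rintro (x | x) h i <;> simp only [RR, Sum.map_inl, Sum.map_inr] at h ⊢ <;>
        exact ⟨h.1.child i, h.1.child i⟩)
    (by
      rintro (x | x) (y | y) h <;> simp only [RR, Sum.map_inl, Sum.map_inr] at h ⊢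
      · exact Filter.Eventually.of_forall (fun i => ⟨h.1.child i, h.2⟩)
      · exact (Bc_child E x y h.2.2).mono (fun i hi => ⟨h.1.child i, h.2.1, hi⟩)
      · refine (Bc_child _ x y ((Bc_comm E k hE _ _ h.1 h.2.1).1 h.2.2)).mono
          (fun i hi => ⟨h.1, h.2.1.child i, ?_⟩)
        exact (Bc_comm E k hE _ _ h.1 (h.2.1.child i)).2 hi
      · exact Filter.Eventually.of_forall (fun i => ⟨h.1.child i, h.2⟩))
    {Sum.inl s, Sum.inr t} (by simp)
    (by
      rintro x (rfl | rfl) y (rfl | rfl) <;> simp only [RR] <;> tauto)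
  refine ⟨{a | Tr.leaf a ∈ {u | Sum.inl u ∈ P}}, {a | Tr.leaf a ∈ {u | Sum.inr u ∈ P}},
    large_of_closed _ ?_ s (hsub (by simp)), large_of_closed _ ?_ t (hsub (by simp)), ?_⟩
  · intro u hu
    exact (hcl _ hu)
  · intro u hu
    exact (hcl _ hu)
  · intro x hx y hy
    have := (hP _ hx _ hy).2.2
    simpa only [Bc, ev_leaf] using this

/-! ### Ordinals -/

universe u v

/-- The canonical tree on `[α, α + ω^j)`. -/
noncomputable def tr : ℕ → Ordinal.{u} → Tr Ordinal.{u}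
  | 0, α => Tr.leaf α
  | j + 1, α => Tr.node (fun i => tr j (α + ω ^ j * (i : Ordinal.{u})))

/-- The canonical tree for `ω^ω`. -/
noncomputable def top : Tr Ordinal.{u} := Tr.node (fun m => tr m (ω ^ m))

theorem step_le (α β : Ordinal.{u}) {i i' : ℕ} (h : i < i') :
    α + β * (i : Ordinal.{u}) + β ≤ α + β * (i' : Ordinal.{u}) := by
  have h1 : β * (i : Ordinal.{u}) + β = β * ((i + 1 : ℕ) : Ordinal.{u}) := by
    rw [Nat.cast_add, Nat.cast_one, mul_add_one]
  rw [add_assoc, h1]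
  gcongr
  exact_mod_cast h

theorem step_le' (α : Ordinal.{u}) (j i : ℕ) :
    α + ω ^ j * (i : Ordinal.{u}) + ω ^ j ≤ α + ω ^ (j + 1) := by
  refine (step_le α (ω ^ j) (Nat.lt_succ_self i)).trans ?_
  rw [pow_succ]
  gcongr
  exact (natCast_lt_omega0 _).le

theorem ev_tr (j : ℕ) (α : Ordinal.{u}) :
    ∀ᶠ x in (U (tr j α) : Filter Ordinal.{u}), α ≤ x ∧ x < α + ω ^ j := by
  induction j generalizing α with
  | zero => simp [tr, ev_leaf]
  | succ j ih =>
    rw [tr, ev_node]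
    refine Filter.Eventually.of_forall (fun i => (ih _).mono (fun x hx => ⟨?_, ?_⟩))
    · exact le_self_add.trans hx.1
    · exact hx.2.trans_le (step_le' α j i)

theorem node_nonprincipal (ch : ℕ → Tr Ordinal.{u}) (lo hi : ℕ → Ordinal.{u})
    (h : ∀ i, ∀ᶠ x in (U (ch i) : Filter Ordinal.{u}), lo i ≤ x ∧ x < hi i)
    (hlt : ∀ i i', i < i' → hi i ≤ lo i') (a : Ordinal.{u}) :
    ∀ᶠ x in (U (Tr.node ch) : Filter Ordinal.{u}), x ≠ a := by
  rw [ev_node]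
  have hss : {i | lo i ≤ a ∧ a < hi i}.Subsingleton := by
    intro i h1 i' h2
    rcases lt_trichotomy i i' with h3 | h3 | h3
    · exact absurd (h1.2.trans_le ((hlt _ _ h3).trans h2.1)) (lt_irrefl _)
    · exact h3
    · exact absurd (h2.2.trans_le ((hlt _ _ h3).trans h1.1)) (lt_irrefl _)
  have h1 : ∀ᶠ i in (hyperfilter ℕ : Filter ℕ), i ∉ {i | lo i ≤ a ∧ a < hi i} :=
    hyperfilter_le_cofinite hss.finite.compl_mem_cofinite
  refine h1.mono (fun i hi' => (h i).mono (fun x hx hxa => hi' (hxa ▸ hx)))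

theorem good_tr (j : ℕ) (α : Ordinal.{u}) : (tr j α).Good := by
  induction j generalizing α with
  | zero => trivial
  | succ j ih =>
    exact ⟨fun i => ih _, node_nonprincipal _ _ _ (fun i => ev_tr j _)
      (fun i i' h => step_le _ _ h)⟩

theorem top_step {m m' : ℕ} (h : m < m') : (ω ^ m + ω ^ m : Ordinal.{u}) ≤ ω ^ m' := by
  have h1 := step_le' (0 : Ordinal.{u}) m 1
  simp only [zero_add, Nat.cast_one, mul_one] at h1
  exact h1.trans (pow_le_pow_right₀ one_lt_omega0.le h)

theorem top_nonprincipal (a : Ordinal.{u}) :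
    ∀ᶠ x in (U top : Filter Ordinal.{u}), x ≠ a :=
  node_nonprincipal _ _ _ (fun i => ev_tr i _) (fun _ _ h => top_step h) a

theorem good_top : (top : Tr Ordinal.{u}).Good :=
  ⟨fun i => good_tr _ _, top_nonprincipal⟩

theorem embed_tr (C : Set Ordinal.{u}) (j : ℕ) (α : Ordinal.{u}) (h : Large C (tr j α)) :
    ∃ f : Ordinal.{v} → Ordinal.{u}, StrictMonoOn f (Set.Iio (ω ^ j)) ∧
      ∀ x < ω ^ j, f x ∈ C ∧ α ≤ f x ∧ f x < α + ω ^ j := by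
  induction j generalizing α with
  | zero =>
    refine ⟨fun _ => α, ?_, ?_⟩
    · intro x hx y hy hxy
      simp at hx hy
      simp [hx, hy] at hxy
    · intro x hx
      exact ⟨h, le_rfl, by simp⟩
  | succ j ih =>
    obtain ⟨φ, hφ, hL⟩ := Filter.extraction_of_frequently_atTop h
    choose g hg1 hg2 using fun n => ih _ (hL n)
    have hpos : (0 : Ordinal.{v}) < ω ^ j := pow_pos omega0_pos _
    have hne : (ω ^ j : Ordinal.{v}) ≠ 0 := hpos.ne'
    have hdiv : ∀ x : Ordinal.{v}, x < ω ^ (j + 1) → ∃ n : ℕ, x / ω ^ j = n := by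
      intro x hx
      rw [← lt_omega0, ← lt_mul_iff_div_lt hne, ← pow_succ]
      exact hx
    choose! N hN using hdiv
    have hmod : ∀ x : Ordinal.{v}, x % ω ^ j < ω ^ j := fun x => mod_lt x hne
    refine ⟨fun x => g (N x) (x % ω ^ j), ?_, ?_⟩
    · intro x hx y hy hxy
      have hle : N x ≤ N y := by
        have : x / ω ^ j ≤ y / ω ^ j := by
          refine (le_div hne).2 ((mul_div_le x _).trans hxy.le)
        rw [hN x hx, hN y hy] at this
        exact_mod_cast this
      rcases hle.eq_or_lt with he | hl
      · have : x % ω ^ j < y % ω ^ j := by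
          have h1 := Ordinal.div_add_mod x (ω ^ j)
          have h2 := Ordinal.div_add_mod y (ω ^ j)
          rw [hN x hx, he] at h1
          rw [hN y hy] at h2
          have h3 := h1.trans_lt (hxy.trans_eq h2.symm)
          exact (add_lt_add_iff_left _).1 h3
        change g (N x) _ < g (N y) _
        rw [he]
        exact hg1 _ (hmod x) (hmod y) this
      · exact (hg2 (N x) _ (hmod x)).2.2.trans_le
          ((step_le _ _ (hφ hl)).trans (hg2 (N y) _ (hmod y)).2.1)
    · intro x hx
      obtain ⟨h1, h2, h3⟩ := hg2 (N x) _ (hmod x)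
      exact ⟨h1, le_self_add.trans h2, h3.trans_le (step_le' _ _ _)⟩

theorem embed_top (C : Set Ordinal.{u}) (h : Large C top) :
    ∃ f : Set.Iio (ω ^ ω : Ordinal.{v}) → Set.Iio (ω ^ ω : Ordinal.{u}), StrictMono f ∧
      ∀ x, (f x : Ordinal.{u}) ∈ C := by
  obtain ⟨φ, hφ, hL⟩ := Filter.extraction_of_frequently_atTop h
  choose g hg1 hg2 using fun n => embed_tr.{u, v} C _ _ (hL n)
  have hlog : ∀ x : Ordinal.{v}, x < ω ^ (ω : Ordinal.{v}) → ∃ n : ℕ, log ω x = n := by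
    intro x hx
    rw [← lt_omega0]
    rcases eq_or_ne x 0 with rfl | h0
    · simp
    · exact (lt_opow_iff_log_lt one_lt_omega0 h0).1 hx
  choose! N hN using hlog
  have hlt : ∀ x : Ordinal.{v}, x < ω ^ (ω : Ordinal.{v}) → ∀ M, N x ≤ M → x < ω ^ φ (M + 1) := by
    intro x hx M hM
    have h1 := lt_opow_succ_log_self one_lt_omega0 x
    rw [hN x hx] at h1
    have h2 : Order.succ ((N x : ℕ) : Ordinal.{v}) = ((N x + 1 : ℕ) : Ordinal.{v}) := by simp
    rw [h2, opow_natCast] at h1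
    refine h1.trans_le (pow_le_pow_right₀ one_lt_omega0.le ?_)
    exact (Nat.succ_le_succ hM).trans hφ.le_apply
  have hb : ∀ x : Set.Iio (ω ^ ω : Ordinal.{v}), g (N x + 1) x < (ω ^ ω : Ordinal.{u}) := by
    rintro ⟨x, hx⟩
    refine (hg2 (N x + 1) x (hlt x hx _ le_rfl)).2.2.trans_le
      ((top_step (Nat.lt_succ_self _)).trans ?_)
    rw [← opow_natCast]
    exact opow_le_opow_right omega0_pos (natCast_lt_omega0 _).le
  refine ⟨fun x => ⟨g (N x + 1) x, hb x⟩, ?_, ?_⟩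
  · rintro ⟨x, hx⟩ ⟨y, hy⟩ hxy
    change g (N x + 1) x < g (N y + 1) y
    replace hxy : x < y := hxy
    have hle : N x ≤ N y := by
      have : log ω x ≤ log ω y := log_mono_right _ hxy.le
      rw [hN x hx, hN y hy] at this
      exact_mod_cast this
    rcases hle.eq_or_lt with he | hl
    · rw [he]
      exact hg1 _ (hlt x hx _ he.le) (hlt y hy _ le_rfl) hxy
    · exact (hg2 (N x + 1) x (hlt x hx _ le_rfl)).2.2.trans_le
        ((top_step (hφ (Nat.succ_lt_succ hl))).trans (hg2 (N y + 1) y (hlt y hy _ le_rfl)).2.1)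
  · rintro ⟨x, hx⟩
    exact (hg2 (N x + 1) x (hlt x hx _ le_rfl)).1

end PolarAux

/-- The polarised partition relation `(ω^ω; ω^ω) → (ω^ω k; ω^ω k)` for every natural
number `k`, where `W` is the set of ordinals below `ω^ω`. -/
theorem stmt_5 (k : ℕ)
    (c : ↥(Set.Iio (omega0 ^ omega0)) → ↥(Set.Iio (omega0 ^ omega0)) → Fin 2) :
    (∃ C D : Set ↥(Set.Iio (omega0 ^ omega0)),
        Nonempty (↥C ≃o ↥(Set.Iio (omega0 ^ omega0))) ∧
        Nonempty (↥D ≃o ↥(Set.Iio (omega0 ^ omega0))) ∧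
        ∀ x ∈ C, ∀ y ∈ D, c x y = 0) ∨
    (∃ C D : Set ↥(Set.Iio (omega0 ^ omega0)),
        C.ncard = k ∧ D.ncard = k ∧ ∀ x ∈ C, ∀ y ∈ D, c x y = 1) := by
  rcases Nat.eq_zero_or_pos k with rfl | hk
  · exact Or.inr ⟨∅, ∅, by simp, by simp, by simp⟩
  by_cases hE : ∃ (F : Finset Ordinal) (G : Finset Ordinal), F.card = k ∧ G.card = k ∧
      ∀ x ∈ F, ∀ y ∈ G, ∃ hx hy, c ⟨x, hx⟩ ⟨y, hy⟩ = 1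
  · right
    obtain ⟨F, G, hF, hG, h⟩ := hE
    obtain ⟨x0, hx0⟩ := Finset.card_pos.1 (hF ▸ hk)
    obtain ⟨y0, hy0⟩ := Finset.card_pos.1 (hG ▸ hk)
    refine ⟨Subtype.val ⁻¹' (F : Set _), Subtype.val ⁻¹' (G : Set _), ?_, ?_, ?_⟩
    · rw [Set.ncard_preimage_of_injective_subset_range Subtype.val_injective,
        Set.ncard_coe_finset, hF]
      intro x hx
      obtain ⟨hx', -⟩ := h x hx y0 hy0
      exact ⟨⟨x, hx'⟩, rfl⟩
    · rw [Set.ncard_preimage_of_injective_subset_range Subtype.val_injective,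
        Set.ncard_coe_finset, hG]
      intro y hy
      obtain ⟨_, hy', -⟩ := h x0 hx0 y hy
      exact ⟨⟨y, hy'⟩, rfl⟩
    · intro x hx y hy
      obtain ⟨_, _, h'⟩ := h x hx y hy
      exact h'
  · left
    obtain ⟨C, D, hC, hD, hCD⟩ := PolarAux.main_tree _ k hE PolarAux.top PolarAux.top
      PolarAux.good_top PolarAux.good_top
      (PolarAux.Bc_of_free _ k hE _ _ PolarAux.top_nonprincipal PolarAux.top_nonprincipal)
    obtain ⟨f, hf, hfC⟩ := PolarAux.embed_top C hC
    obtain ⟨g, hg, hgD⟩ := PolarAux.embed_top D hD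
    refine ⟨Set.range f, Set.range g, ⟨(hf.orderIso f).symm⟩, ⟨(hg.orderIso g).symm⟩, ?_⟩
    rintro _ ⟨x, rfl⟩ _ ⟨y, rfl⟩
    by_contra hne
    refine hCD _ (hfC x) _ (hgD y) ⟨(f x).2, (g y).2, ?_⟩
    exact Fin.eq_one_of_ne_zero _ hne
end

section
/- Let α and β be ordinals with α < ω^ω and β < ω^ω, and let n be a natural number. Let A be the set of ordinals below ω·α (the ordinal consisting of α copies of ω) and B the set of ordinals below ω·β, each with its natural well-order. For every colouring c : A × B → {0,1}, either there exist C ⊆ A of order type ω·α and D ⊆ B of order type ω·β with c constantly 0 on C × D, or there exist C ⊆ A and D ⊆ B with |C| = |D| = n and c constantly 1 on C × D. -/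
open Ordinal

universe u v

namespace PolarPart

/-- Quantifier for almost all leaves below the node `s`, with `d` levels remaining. -/
def Ev : ℕ → List ℕ → (List ℕ → Prop) → Prop
  | 0, s, p => p s
  | d + 1, s, p => ∀ᶠ v in (Filter.hyperfilter ℕ : Filter ℕ), Ev d (v :: s) p

lemma Ev_mono {d : ℕ} {s : List ℕ} {p q : List ℕ → Prop} (h : ∀ x, p x → q x)
    (hp : Ev d s p) : Ev d s q := by
  induction d generalizing s with
  | zero => exact h _ hp
  | succ d ih => exact Filter.Eventually.mono hp fun v hv => ih hv

lemma Ev_not {d : ℕ} {s : List ℕ} {p : List ℕ → Prop} :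
    Ev d s (fun x => ¬ p x) ↔ ¬ Ev d s p := by
  induction d generalizing s with
  | zero => exact Iff.rfl
  | succ d ih =>
    simp only [Ev, ih]
    exact Ultrafilter.eventually_not

lemma Ev_true {d : ℕ} {s : List ℕ} {p : List ℕ → Prop} (h : ∀ x, p x) : Ev d s p := by
  induction d generalizing s with
  | zero => exact h _
  | succ d ih => exact Filter.Eventually.of_forall fun v => ih

lemma Ev_and {d : ℕ} {s : List ℕ} {p q : List ℕ → Prop} (hp : Ev d s p) (hq : Ev d s q) :
    Ev d s (fun x => p x ∧ q x) := by
  induction d generalizing s with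
  | zero => exact ⟨hp, hq⟩
  | succ d ih => exact Filter.Eventually.mp hq (Filter.Eventually.mono hp fun v h1 h2 => ih h1 h2)

lemma Ev_finset {d : ℕ} {s : List ℕ} (S : Finset (List ℕ)) (p : List ℕ → List ℕ → Prop)
    (h : ∀ x ∈ S, Ev d s (p x)) : Ev d s (fun y => ∀ x ∈ S, p x y) := by
  classical
  induction S using Finset.induction_on with
  | empty => exact Ev_true (by simp)
  | insert a S ha ih =>
    refine Ev_mono ?_ (Ev_and (h a (by simp)) (ih fun x hx => h x (by simp [hx])))
    rintro y ⟨h1, h2⟩ x hx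
    rcases Finset.mem_insert.1 hx with rfl | hx
    · exact h1
    · exact h2 x hx

lemma Ev_exists {d : ℕ} {s : List ℕ} {p : List ℕ → Prop} (h : Ev d s p) :
    ∃ w : List ℕ, w.length = d ∧ p (w ++ s) := by
  induction d generalizing s with
  | zero => exact ⟨[], rfl, h⟩
  | succ d ih =>
    obtain ⟨v, hv⟩ := Filter.Eventually.exists h
    obtain ⟨w, hw, hp⟩ := ih hv
    exact ⟨w ++ [v], by simp [hw], by simpa using hp⟩

lemma hyper_infinite {p : ℕ → Prop} (h : ∀ᶠ v in (Filter.hyperfilter ℕ : Filter ℕ), p v) :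
    {v | p v}.Infinite := by
  intro hf
  exact Filter.notMem_hyperfilter_of_finite hf h

lemma hyper_of_finite {p : ℕ → Prop} (h : {v | ¬ p v}.Finite) :
    ∀ᶠ v in (Filter.hyperfilter ℕ : Filter ℕ), p v := by
  have := Filter.compl_mem_hyperfilter_of_finite h
  filter_upwards [this] with v hv
  simpa using hv

lemma Ev_infinite {d : ℕ} {s : List ℕ} {p : List ℕ → Prop} (h : Ev (d + 1) s p) :
    {y | y.length = d + 1 + s.length ∧ p y}.Infinite := by
  have hi := hyper_infinite h
  have hc : ∀ v : {v | Ev d (v :: s) p}, ∃ w : List ℕ, w.length = d ∧ p (w ++ v.1 :: s) :=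
    fun v => Ev_exists v.2
  choose w hw hp using hc
  have : Infinite {v | Ev d (v :: s) p} := hi.to_subtype
  refine Set.infinite_of_injective_forall_mem (f := fun v => w v ++ v.1 :: s) ?_ ?_
  · intro v v' hvv
    have := List.append_inj hvv (by rw [hw, hw])
    simp only [List.cons.injEq, and_true] at this
    exact Subtype.ext this.2
  · intro v
    refine ⟨?_, hp v⟩
    simp [hw]; omega

/-- Greedy construction. -/
lemma greedy {τ : Type} (code : τ → ℕ) (hinj : Function.Injective code) (n0 : ℕ)
    (valid : ℕ → (τ → ℕ) → Prop)
    (hloc : ∀ n φ ψ, (∀ t, code t < n → φ t = ψ t) → valid n φ → valid n ψ)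
    (h0 : ∀ φ, valid n0 φ)
    (hs : ∀ n φ, n0 ≤ n → valid n φ → ∃ ψ, (∀ t, code t < n → φ t = ψ t) ∧ valid (n + 1) ψ) :
    ∃ φ, ∀ n, n0 ≤ n → valid n φ := by
  classical
  let Φ : (m : ℕ) → {φ : τ → ℕ // valid (n0 + m) φ} := fun m => Nat.rec ⟨fun _ => 0, h0 _⟩
    (fun m φ => ⟨(hs (n0 + m) φ.1 (by omega) φ.2).choose,
      (hs (n0 + m) φ.1 (by omega) φ.2).choose_spec.2⟩) m
  have hΦ : ∀ m t, code t < n0 + m → (Φ m).1 t = (Φ (m + 1)).1 t := fun m =>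
    (hs (n0 + m) (Φ m).1 (by omega) (Φ m).2).choose_spec.1
  have hΦ' : ∀ m k t, code t < n0 + m → (Φ m).1 t = (Φ (m + k)).1 t := by
    intro m k t ht
    induction k with
    | zero => rfl
    | succ k ih => rw [ih]; exact hΦ (m + k) t (by omega)
  refine ⟨fun t => (Φ (code t + 1)).1 t, fun n hn => ?_⟩
  obtain ⟨m, rfl⟩ := Nat.exists_eq_add_of_le hn
  refine hloc _ _ _ ?_ (Φ m).2
  intro t ht
  have hcomm : ∀ a b, a = b → (Φ a).1 = (Φ b).1 := by rintro a _ rfl; rfl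
  rw [hΦ' m (code t + 1) t ht, hΦ' (code t + 1) m t (by omega), hcomm _ _ (Nat.add_comm _ _)]

def code (t : Bool × List ℕ) : ℕ := 2 * Encodable.encode t.2 + t.1.toNat

lemma code_inj : Function.Injective code := by
  rintro ⟨b, s⟩ ⟨b', s'⟩ h
  simp only [code] at h
  have hb : b = b' := by
    cases b <;> cases b' <;> simp at h ⊢ <;> omega
  subst hb
  have : s = s' := Encodable.encode_injective (by omega)
  rw [this]

lemma code_parent (b : Bool) (i : ℕ) (s : List ℕ) : code (b, s) < code (b, i :: s) := by
  have := Nat.right_le_pair i (Encodable.encode s)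
  simp only [code, Encodable.encode_list_cons, Encodable.encode_nat]
  omega

lemma code_sib (b : Bool) {i j : ℕ} (s : List ℕ) (h : i < j) :
    code (b, i :: s) < code (b, j :: s) := by
  have := Nat.pair_lt_pair_left (Encodable.encode s) h
  simp only [code, Encodable.encode_list_cons, Encodable.encode_nat]
  omega

lemma code_lt_two {b : Bool} {s : List ℕ} (h : code (b, s) < 2) : s = [] := by
  cases s with
  | nil => rfl
  | cons a s =>
    simp only [code, Encodable.encode_list_cons] at h
    omega

lemma code_nil (b : Bool) : code (b, []) < 2 := by
  cases b <;> simp [code]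

lemma code_finite (n : ℕ) : {t | code t < n}.Finite :=
  Set.Finite.preimage code_inj.injOn (Set.finite_lt_nat n)

/-- The node map. -/
def F (φ : Bool × List ℕ → ℕ) (b : Bool) : List ℕ → List ℕ
  | [] => []
  | i :: s => φ (b, i :: s) :: F φ b s

lemma F_length (φ b s) : (F φ b s).length = s.length := by
  induction s with
  | nil => rfl
  | cons i s ih => simp [F, ih]

lemma F_congr {φ ψ : Bool × List ℕ → ℕ} {n : ℕ} (h : ∀ t, code t < n → φ t = ψ t) (b : Bool)
    (s : List ℕ) (hs : code (b, s) < n) : F φ b s = F ψ b s := by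
  induction s with
  | nil => rfl
  | cons i s ih =>
    simp only [F]
    rw [h _ hs, ih ((code_parent b i s).trans hs)]

structure Valid (k : Bool → ℕ) (R : Bool → List ℕ → List ℕ → Prop) (n : ℕ)
    (φ : Bool × List ℕ → ℕ) : Prop where
  mono : ∀ b i j s, i < j → code (b, j :: s) < n → φ (b, i :: s) < φ (b, j :: s)
  indep : ∀ b s t, code (b, s) < n → code (!b, t) < n → s.length = k b → t.length ≤ k (!b) →
    Ev (k (!b) - t.length) (F φ (!b) t) (fun y => ¬ R b (F φ b s) y)

lemma core (k : Bool → ℕ) (hk : ∀ b, 1 ≤ k b) (R : Bool → List ℕ → List ℕ → Prop)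
    (hR : ∀ b x y, R b x y ↔ R (!b) y x)
    (H : ∀ b t, t.length < k (!b) →
      {x | x.length = k b ∧ ¬ Ev (k (!b) - t.length) t (fun y => ¬ R b x y)}.Finite) :
    ∃ φ, ∀ n, 2 ≤ n → Valid k R n φ := by
  classical
  refine greedy code code_inj 2 (Valid k R) ?_ ?_ ?_
  · intro n φ ψ h hv
    constructor
    · intro b i j s hij hc
      rw [← h _ hc, ← h _ ((code_sib b s hij).trans hc)]
      exact hv.mono b i j s hij hc
    · intro b s t hs ht hsl htl
      rw [← F_congr h _ _ hs, ← F_congr h _ _ ht]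
      exact hv.indep b s t hs ht hsl htl
  · intro φ
    constructor
    · intro b i j s _ hc
      exact absurd (code_lt_two hc) (by simp)
    · intro b s t hs _ hsl
      have := code_lt_two hs
      have := hk b
      subst s
      simp at hsl
      omega
  · intro n φ hn hv
    by_cases hex : ∃ t, code t = n
    swap
    · refine ⟨φ, fun _ _ => rfl, ?_⟩
      have hlt : ∀ t, code t < n + 1 → code t < n := by
        intro t ht
        have : code t ≠ n := fun h => hex ⟨t, h⟩
        omega
      exact ⟨fun b i j s hij hc => hv.mono b i j s hij (hlt _ hc),
        fun b s t hs ht => hv.indep b s t (hlt _ hs) (hlt _ ht)⟩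
    obtain ⟨⟨b0, s0⟩, hc0⟩ := hex
    obtain ⟨i0, s1, rfl⟩ : ∃ i0 s1, s0 = i0 :: s1 := by
      cases s0 with
      | nil => exact absurd (code_nil b0) (by omega)
      | cons i s => exact ⟨i, s, rfl⟩
    have hs1 : code (b0, s1) < n := hc0 ▸ code_parent b0 i0 s1
    have e1 : ∀ᶠ v in (Filter.hyperfilter ℕ : Filter ℕ), ∀ i < i0, φ (b0, i :: s1) < v := by
      refine (Filter.eventually_all_finite (Set.finite_lt_nat i0)).2 fun i _ => ?_
      refine hyper_of_finite ?_
      simpa using Set.finite_le_nat (φ (b0, i :: s1))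
    have e2 : ∀ᶠ v in (Filter.hyperfilter ℕ : Filter ℕ), ∀ t ∈ {t | code t < n},
        t.1 = (!b0) → t.2.length = k (!b0) → (i0 :: s1).length ≤ k b0 →
        Ev (k b0 - (i0 :: s1).length) (v :: F φ b0 s1)
          (fun y => ¬ R (!b0) (F φ (!b0) t.2) y) := by
      refine (Filter.eventually_all_finite (code_finite n)).2 ?_
      rintro ⟨b, t⟩ ht
      by_cases hb : b = !b0
      swap
      · exact Filter.Eventually.of_forall fun v h => absurd h hb
      subst hb
      by_cases hl : t.length = k (!b0) ∧ (i0 :: s1).length ≤ k b0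
      swap
      · exact Filter.Eventually.of_forall fun v _ h1 h2 => absurd ⟨h1, h2⟩ hl
      have := hv.indep (!b0) t s1 ht (by simpa using hs1) hl.1
        (by simp only [Bool.not_not]; have := hl.2; simp at this; omega)
      simp only [Bool.not_not] at this
      have h2 := hl.2
      simp only [List.length_cons] at h2
      obtain ⟨d, hd⟩ : ∃ d, k b0 - s1.length = d + 1 := ⟨k b0 - s1.length - 1, by omega⟩
      rw [hd] at this
      refine Filter.Eventually.mono this fun v hv' _ _ _ => ?_
      have hd' : k b0 - (i0 :: s1).length = d := by simp only [List.length_cons]; omega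
      rw [hd']
      exact hv'
    have e3 : ∀ᶠ v in (Filter.hyperfilter ℕ : Filter ℕ), ∀ t ∈ {t | code t < n},
        t.1 = (!b0) → t.2.length < k (!b0) → (i0 :: s1).length = k b0 →
        Ev (k (!b0) - t.2.length) (F φ (!b0) t.2)
          (fun y => ¬ R b0 (v :: F φ b0 s1) y) := by
      refine (Filter.eventually_all_finite (code_finite n)).2 ?_
      rintro ⟨b, t⟩ ht
      by_cases hl : t.length < k (!b0) ∧ (i0 :: s1).length = k b0
      swap
      · exact Filter.Eventually.of_forall fun v _ h1 h2 => absurd ⟨h1, h2⟩ hl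
      have hfin := H b0 (F φ (!b0) t) (by rw [F_length]; exact hl.1)
      have hfin2 := Set.Finite.preimage (f := fun v : ℕ => v :: F φ b0 s1)
        (fun a _ b _ h => by simpa using h) hfin
      refine hyper_of_finite (hfin2.subset ?_)
      intro v hv'
      simp only [Set.mem_ofPred_eq, not_forall] at hv'
      obtain ⟨_, _, _, h⟩ := hv'
      refine ⟨?_, ?_⟩
      · have := hl.2
        simp only [List.length_cons, F_length] at this ⊢
        exact this
      · rw [F_length]; exact h
    obtain ⟨v, h1, h2, h3⟩ := (e1.and (e2.and e3)).exists
    have hag : ∀ t, code t < n → φ t = Function.update φ (b0, i0 :: s1) v t := by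
      intro t ht
      rw [Function.update_of_ne]
      rintro rfl
      omega
    refine ⟨Function.update φ (b0, i0 :: s1) v, hag, ?_⟩
    have hnew : ∀ t, code t < n + 1 → code t < n ∨ t = (b0, i0 :: s1) := by
      intro t ht
      by_cases h : code t = n
      · exact Or.inr (code_inj (h.trans hc0.symm))
      · left; omega
    have hF0 : F (Function.update φ (b0, i0 :: s1) v) b0 (i0 :: s1) = v :: F φ b0 s1 := by
      simp only [F, Function.update_self]
      rw [← F_congr hag b0 s1 hs1]
    constructor
    · intro b i j s hij hc
      rcases hnew _ hc with hc | hc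
      · rw [← hag _ hc, ← hag _ ((code_sib b s hij).trans hc)]
        exact hv.mono b i j s hij hc
      · simp only [Prod.mk.injEq, List.cons.injEq] at hc
        obtain ⟨rfl, rfl, rfl⟩ := hc
        rw [Function.update_self, ← hag _ (hc0 ▸ code_sib b s hij)]
        exact h1 i hij
    · intro b s t hs ht hsl htl
      rcases hnew _ hs with hs | hs
      · rcases hnew _ ht with ht | ht
        · rw [← F_congr hag _ _ hs, ← F_congr hag _ _ ht]
          exact hv.indep b s t hs ht hsl htl
        · simp only [Prod.mk.injEq] at ht
          obtain ⟨hb, rfl⟩ := ht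
          subst hb
          rw [hF0, ← F_congr hag _ _ hs]
          have := h2 (b, s) hs (by simp) (by simpa using hsl) htl
          simpa using this
      · simp only [Prod.mk.injEq] at hs
        obtain ⟨rfl, rfl⟩ := hs
        rcases hnew _ ht with ht | ht
        · rw [hF0, ← F_congr hag _ _ ht]
          rcases htl.lt_or_eq with htl | htl
          · exact h3 (!b, t) ht rfl htl hsl
          · have := h2 (!b, t) ht rfl htl hsl.le
            rw [hsl] at this
            rw [htl]
            simp only [Nat.sub_self, Ev] at this ⊢
            rwa [hR]
        · simp at ht

/-- Image of a path (read from the root) below the node `s`. -/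
def G (φ : Bool × List ℕ → ℕ) (b : Bool) : List ℕ → List ℕ → List ℕ
  | _, [] => []
  | s, a :: l => φ (b, a :: s) :: G φ b (a :: s) l

lemma F_eq_G (φ b) (l s : List ℕ) : F φ b (l.reverse ++ s) = (G φ b s l).reverse ++ F φ b s := by
  induction l generalizing s with
  | nil => rfl
  | cons a l ih => simp [G, ih, F]

lemma G_length (φ b) (l s : List ℕ) : (G φ b s l).length = l.length := by
  induction l generalizing s with
  | nil => rfl
  | cons a l ih => simp [G, ih]

lemma G_mono {φ : Bool × List ℕ → ℕ} {b}
    (h : ∀ i j s, i < j → φ (b, i :: s) < φ (b, j :: s)) (l l' s : List ℕ) (hll : l < l') :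
    G φ b s l < G φ b s l' := by
  induction l generalizing s l' with
  | nil =>
    cases l' with
    | nil => simp at hll
    | cons a l => simp [G]
  | cons a l ih =>
    cases l' with
    | nil => simp at hll
    | cons a' l' =>
      simp only [G]
      rw [List.cons_lt_cons_iff] at hll ⊢
      rcases hll with hll | ⟨rfl, hll⟩
      · exact Or.inl (h _ _ _ hll)
      · exact Or.inr ⟨rfl, ih _ _ hll⟩

/-- Leaves of the tree of height `k`. -/
abbrev X (k : ℕ) := {l : List ℕ // l.length = k}

abbrev rX (k : ℕ) : X k → X k → Prop := fun a b => a.1 < b.1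

/-- `E` has no complete bipartite subgraph with `n` points on both sides. -/
def NoK {A B : Type*} (n : ℕ) (E : A → B → Prop) : Prop :=
  ∀ (S : Finset A) (T : Finset B), S.card = n → T.card = n → ∃ x ∈ S, ∃ y ∈ T, ¬ E x y

def Good {A B : Type*} (n : ℕ) (r : A → A → Prop) (s : B → B → Prop) : Prop :=
  ∀ E : A → B → Prop, NoK n E → ∃ (f : r ↪r r) (g : s ↪r s), ∀ x y, ¬ E (f x) (g y)

lemma noK_swap {A B : Type*} {n : ℕ} {E : A → B → Prop} (h : NoK n E) :
    NoK n (fun y x => E x y) := by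
  intro S T hS hT
  obtain ⟨x, hx, y, hy, hxy⟩ := h T S hT hS
  exact ⟨y, hy, x, hx, hxy⟩

lemma noK_comp {A B A' B' : Type*} {n : ℕ} {E : A → B → Prop} (h : NoK n E)
    (f : A' ↪ A) (g : B' ↪ B) : NoK n (fun x y => E (f x) (g y)) := by
  intro S T hS hT
  obtain ⟨x, hx, y, hy, hxy⟩ := h (S.map f) (T.map g) (by simpa using hS) (by simpa using hT)
  obtain ⟨x, hx', rfl⟩ := Finset.mem_map.1 hx
  obtain ⟨y, hy', rfl⟩ := Finset.mem_map.1 hy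
  exact ⟨x, hx', y, hy', hxy⟩

lemma Good.symm {A B : Type*} {n : ℕ} {r : A → A → Prop} {s : B → B → Prop} (h : Good n r s) :
    Good n s r := by
  intro E hE
  obtain ⟨f, g, hfg⟩ := h _ (noK_swap hE)
  exact ⟨g, f, fun x y => hfg y x⟩

lemma Good.iso {A A' B : Type*} {n : ℕ} {r : A → A → Prop} {r' : A' → A' → Prop}
    {s : B → B → Prop} (h : Good n r s) (e : r ≃r r') : Good n r' s := by
  intro E hE
  obtain ⟨f, g, hfg⟩ := h _ (noK_comp hE e.toEquiv.toEmbedding (Function.Embedding.refl _))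
  exact ⟨(e.symm.toRelEmbedding.trans f).trans e.toRelEmbedding, g, fun x y => hfg _ y⟩

lemma Good.sum {A A' B : Type*} {n : ℕ} {r : A → A → Prop} {r' : A' → A' → Prop}
    {s : B → B → Prop} (h : Good n r s) (h' : Good n r' s) : Good n (Sum.Lex r r') s := by
  intro E hE
  obtain ⟨f, g, hfg⟩ := h _ (noK_comp hE Function.Embedding.inl (Function.Embedding.refl _))
  obtain ⟨f', g', hfg'⟩ := h' _ (noK_comp hE Function.Embedding.inr g.toEmbedding)
  refine ⟨RelEmbedding.sumLexMap f f', g'.trans g, ?_⟩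
  rintro (x | x) y
  · exact hfg x _
  · exact hfg' x _

lemma Good.empty {A B : Type*} [IsEmpty A] {n : ℕ} {r : A → A → Prop}
    {s : B → B → Prop} : Good n r s :=
  fun _ _ => ⟨RelEmbedding.refl _, RelEmbedding.refl _, fun x => isEmptyElim x⟩

lemma H_of_noK {k l n : ℕ} (E : List ℕ → List ℕ → Prop)
    (hE : ∀ S T : Finset (List ℕ), (∀ x ∈ S, x.length = k) → (∀ y ∈ T, y.length = l) →
      S.card = n → T.card = n → ∃ x ∈ S, ∃ y ∈ T, ¬ E x y) (t : List ℕ) (ht : t.length < l) :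
    {x | x.length = k ∧ ¬ Ev (l - t.length) t (fun y => ¬ E x y)}.Finite := by
  by_contra hinf
  obtain ⟨S, hS, hSc⟩ := Set.Infinite.exists_subset_card_eq hinf n
  obtain ⟨d, hd⟩ : ∃ d, l - t.length = d + 1 := ⟨l - t.length - 1, by omega⟩
  have h1 : Ev (d + 1) t (fun y => ∀ x ∈ S, E x y) := by
    refine Ev_finset S E fun x hx => ?_
    have := (hS hx).2
    rwa [Ev_not, not_not, hd] at this
  obtain ⟨T, hT, hTc⟩ := Set.Infinite.exists_subset_card_eq (Ev_infinite h1) n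
  obtain ⟨x, hx, y, hy, hxy⟩ := hE S T (fun x hx => (hS hx).1)
    (fun y hy => by have := (hT hy).1; omega) hSc hTc
  exact hxy ((hT hy).2 x hx)

lemma good_X (n k l : ℕ) (hk : 1 ≤ k) (hl : 1 ≤ l) : Good n (rX k) (rX l) := by
  classical
  intro E hE
  let E' : List ℕ → List ℕ → Prop := fun x y =>
    ∃ (hx : x.reverse.length = k) (hy : y.reverse.length = l), E ⟨x.reverse, hx⟩ ⟨y.reverse, hy⟩
  have hE' : ∀ S T : Finset (List ℕ), (∀ x ∈ S, x.length = k) → (∀ y ∈ T, y.length = l) →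
      S.card = n → T.card = n → ∃ x ∈ S, ∃ y ∈ T, ¬ E' x y := by
    intro S T hS hT hSc hTc
    by_contra! hcon
    let u : S → X k := fun x => ⟨x.1.reverse, by rw [List.length_reverse]; exact hS x.1 x.2⟩
    let w : T → X l := fun x => ⟨x.1.reverse, by rw [List.length_reverse]; exact hT x.1 x.2⟩
    have hu : Function.Injective u := fun a b h =>
      Subtype.ext (List.reverse_injective (congrArg Subtype.val h))
    have hw : Function.Injective w := fun a b h =>
      Subtype.ext (List.reverse_injective (congrArg Subtype.val h))
    obtain ⟨x, hx, y, hy, hxy⟩ := hE (S.attach.image u) (T.attach.image w)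
      (by rw [Finset.card_image_of_injective _ hu, Finset.card_attach, hSc])
      (by rw [Finset.card_image_of_injective _ hw, Finset.card_attach, hTc])
    obtain ⟨x, _, rfl⟩ := Finset.mem_image.1 hx
    obtain ⟨y, _, rfl⟩ := Finset.mem_image.1 hy
    obtain ⟨_, _, h⟩ := hcon x.1 x.2 y.1 y.2
    exact hxy h
  let K : Bool → ℕ := fun b => if b then l else k
  let R : Bool → List ℕ → List ℕ → Prop := fun b x y => if b then E' y x else E' x y
  obtain ⟨φ, hφ⟩ := core K (by rintro (_ | _) <;> simp [K, hk, hl]) R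
    (by rintro (_ | _) x y <;> simp [R]) (by
      rintro (_ | _) t ht
      · exact H_of_noK E' hE' t ht
      · refine H_of_noK (n := n) (fun y x => E' x y) ?_ t ht
        intro S T hS hT hSc hTc
        obtain ⟨x, hx, y, hy, hxy⟩ := hE' T S hT hS hTc hSc
        exact ⟨y, hy, x, hx, hxy⟩)
  have hmono : ∀ b i j s, i < j → φ (b, i :: s) < φ (b, j :: s) := fun b i j s hij =>
    (hφ (code (b, j :: s) + 2) (by omega)).mono b i j s hij (by omega)
  have emb : ∀ m b, ∃ f : rX m ↪r rX m, ∀ x, (f x).1 = G φ b [] x.1 := by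
    intro m b
    have hm : StrictMono (fun x : X m => (⟨G φ b [] x.1, by rw [G_length]; exact x.2⟩ : X m)) :=
      fun x y hxy => G_mono (hmono b) _ _ _ hxy
    exact ⟨⟨⟨_, hm.injective⟩, fun {a b} => hm.lt_iff_lt⟩, fun x => rfl⟩
  obtain ⟨f, hf⟩ := emb k false
  obtain ⟨g, hg⟩ := emb l true
  refine ⟨f, g, fun x y hxy => ?_⟩
  have := (hφ (code (false, x.1.reverse) + code (true, y.1.reverse) + 2) (by omega)).indep
    false x.1.reverse y.1.reverse (by omega) (by simp only [Bool.not_false]; omega)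
    (by simp [K, x.2]) (by simp [K, y.2])
  have hF : ∀ b (z : List ℕ), (F φ b z.reverse).reverse = G φ b [] z := by
    intro b z
    have := F_eq_G φ b z []
    simp only [List.append_nil, F] at this
    rw [this, List.reverse_reverse]
  have h0 : K (!false) - y.1.reverse.length = 0 := by simp [K, y.2]
  rw [h0] at this
  refine this ?_
  have e1 : (F φ false x.1.reverse).reverse = (f x).1 := by rw [hF, hf]
  have e2 : (F φ true y.1.reverse).reverse = (g y).1 := by rw [hF, hg]
  simp only [R, Bool.not_false, E', Bool.false_eq_true, if_false]
  refine ⟨by rw [e1]; exact (f x).2, by rw [e2]; exact (g y).2, ?_⟩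
  simpa only [e1, e2] using hxy

/-- Relation of an ordinal. -/
abbrev rO (o : Ordinal) : o.ToType → o.ToType → Prop := (· < ·)

lemma iso_X (k : ℕ) : Nonempty (rX k ≃r rO (omega0.{u} ^ (k : Ordinal.{u}))) := by
  induction k with
  | zero =>
    have h1 : Unique (omega0.{u} ^ ((0 : ℕ) : Ordinal.{u})).ToType := by
      rw [Nat.cast_zero, opow_zero]; infer_instance
    let e : X 0 ≃ (omega0.{u} ^ ((0 : ℕ) : Ordinal.{u})).ToType :=
      { toFun := fun _ => default
        invFun := fun _ => ⟨[], rfl⟩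
        left_inv := by rintro ⟨x, hx⟩; exact Subtype.ext (List.length_eq_zero_iff.1 hx).symm
        right_inv := fun x => Subsingleton.elim _ _ }
    refine ⟨⟨e, ?_⟩⟩
    rintro ⟨a, ha⟩ ⟨b, hb⟩
    obtain rfl := List.length_eq_zero_iff.1 ha
    obtain rfl := List.length_eq_zero_iff.1 hb
    simp [rX, rO]
  | succ k ih =>
    obtain ⟨e⟩ := ih
    let e1 : rX (k + 1) ≃r Prod.Lex ((· < ·) : ℕ → ℕ → Prop) (rX k) :=
      { toFun := fun x => (x.1.head (by rintro h; have := x.2; simp [h] at this),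
          ⟨x.1.tail, by simp [x.2]⟩)
        invFun := fun x => ⟨x.1 :: x.2.1, by simp [x.2.2]⟩
        left_inv := by
          rintro ⟨x, hx⟩
          cases x with
          | nil => simp at hx
          | cons a x => rfl
        right_inv := by rintro ⟨a, x, hx⟩; rfl
        map_rel_iff' := by
          rintro ⟨x, hx⟩ ⟨y, hy⟩
          cases x with
          | nil => simp at hx
          | cons a x =>
            cases y with
            | nil => simp at hy
            | cons b y =>
              simp [Prod.lex_def, rX, List.cons_lt_cons_iff] }
    obtain ⟨e2⟩ : Nonempty (((· < ·) : ℕ → ℕ → Prop) ≃r rO omega0.{u}) := by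
      refine lift_type_eq.{0, u, u}.1 ?_
      rw [type_toType, type_nat_lt]; simp
    have e3 : Nonempty (Prod.Lex (rO omega0.{u}) (rO (omega0.{u} ^ (k : Ordinal.{u}))) ≃r
        rO (omega0.{u} ^ ((k + 1 : ℕ) : Ordinal.{u}))) := by
      refine type_eq.1 ?_
      rw [type_prod_lex, type_toType, type_toType, type_toType, Nat.cast_succ, opow_add, opow_one]
    obtain ⟨e3⟩ := e3
    exact ⟨(e1.trans (RelIso.prodLexCongr e2 e)).trans e3⟩

section
variable {B : Type v} {n : ℕ} {s : B → B → Prop}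

lemma good_add {a b : Ordinal.{u}} (ha : Good n (rO a) s) (hb : Good n (rO b) s) :
    Good n (rO (a + b)) s := by
  have : Nonempty (Sum.Lex (rO a) (rO b) ≃r rO (a + b)) := by
    refine type_eq.1 ?_
    rw [type_sum_lex, type_toType, type_toType, type_toType]
  obtain ⟨e⟩ := this
  exact (ha.sum hb).iso e

lemma good_all (h : ∀ k : ℕ, 1 ≤ k → Good n (rX k) s) (α : Ordinal.{u})
    (hα : α < omega0 ^ omega0) : Good n (rO (omega0 * α)) s := by
  have hz : Good n (rO (0 : Ordinal.{u})) s := Good.empty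
  have key : ∀ k : ℕ, ∀ α : Ordinal.{u}, α < omega0 ^ (k : Ordinal.{u}) →
      Good n (rO (omega0 * α)) s := by
    intro k
    induction k with
    | zero =>
      intro α hα
      have : α = 0 := by simpa using hα
      subst this
      rw [mul_zero]; exact hz
    | succ k ih =>
      intro α hα
      have h0 : omega0.{u} ^ (k : Ordinal.{u}) ≠ 0 := opow_ne_zero _ omega0_ne_zero
      rw [Nat.cast_succ, opow_add, opow_one, lt_mul_iff_div_lt h0] at hα
      obtain ⟨m, hm⟩ := lt_omega0.1 hα
      rw [← div_add_mod α (omega0 ^ (k : Ordinal.{u})), mul_add, hm]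
      refine good_add ?_ (ih _ (mod_lt _ h0))
      clear hm hα
      induction m with
      | zero =>
        have e0 : omega0.{u} * (omega0 ^ (k : Ordinal.{u}) * ((0 : ℕ) : Ordinal.{u})) = 0 := by simp
        rw [e0]; exact hz
      | succ m ihm =>
        rw [Nat.cast_succ, mul_add, mul_add, mul_one]
        refine good_add ihm ?_
        obtain ⟨e⟩ := iso_X.{u} (k + 1)
        have := (h (k + 1) (by omega)).iso e
        have heq : omega0.{u} ^ ((k + 1 : ℕ) : Ordinal.{u}) = omega0 * omega0 ^ (k : Ordinal.{u}) := by
          rw [opow_natCast, opow_natCast, pow_succ']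
        rwa [heq] at this
  obtain ⟨c, hc, m, hm⟩ := (lt_omega0_opow omega0_ne_zero).1 hα
  obtain ⟨k, rfl⟩ := lt_omega0.1 hc
  refine key (k + 1) α (hm.trans ?_)
  rw [Nat.cast_succ, opow_add, opow_one]
  exact mul_lt_mul_of_pos_left (natCast_lt_omega0 m) (opow_pos _ omega0_pos)

end

end PolarPart

/-- The polarised partition relation `(ωα; ωβ) → (ωα n; ωβ n)` for ordinals
`α, β < ω^ω` and every natural number `n`. In Mathlib's convention, the ordinal
consisting of `α` copies of `ω` is `ω * α`. -/
theorem stmt_8 (α β : Ordinal) (hα : α < omega0 ^ omega0) (hβ : β < omega0 ^ omega0)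
    (n : ℕ) (c : ↥(Set.Iio (omega0 * α)) → ↥(Set.Iio (omega0 * β)) → Fin 2) :
    (∃ (C : Set ↥(Set.Iio (omega0 * α))) (D : Set ↥(Set.Iio (omega0 * β))),
        Nonempty (↥C ≃o ↥(Set.Iio (omega0 * α))) ∧
        Nonempty (↥D ≃o ↥(Set.Iio (omega0 * β))) ∧
        ∀ x ∈ C, ∀ y ∈ D, c x y = 0) ∨
    (∃ (C : Set ↥(Set.Iio (omega0 * α))) (D : Set ↥(Set.Iio (omega0 * β))),
        C.ncard = n ∧ D.ncard = n ∧ ∀ x ∈ C, ∀ y ∈ D, c x y = 1) := by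
  rw [or_iff_not_imp_right]
  intro hno
  have hgood : PolarPart.Good n (PolarPart.rO (omega0 * α)) (PolarPart.rO (omega0 * β)) :=
    PolarPart.good_all (fun k hk => (PolarPart.good_all
      (fun l hl => PolarPart.good_X n l k hl hk) β hβ).symm) α hα
  have hgood2 : PolarPart.Good n
      ((· < ·) : ↥(Set.Iio (omega0 * α)) → ↥(Set.Iio (omega0 * α)) → Prop)
      ((· < ·) : ↥(Set.Iio (omega0 * β)) → ↥(Set.Iio (omega0 * β)) → Prop) :=
    ((hgood.iso ToType.mk.symm.toRelIsoLT).symm.iso ToType.mk.symm.toRelIsoLT).symm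
  obtain ⟨f, g, hfg⟩ := hgood2 (fun x y => c x y = 1) (by
    intro S T hS hT
    by_contra! hcon
    exact hno ⟨S, T, by simpa using hS, by simpa using hT, hcon⟩)
  let f' := OrderEmbedding.ofStrictMono f (fun a b h => f.map_rel_iff.2 h)
  let g' := OrderEmbedding.ofStrictMono g (fun a b h => g.map_rel_iff.2 h)
  refine ⟨Set.range f', Set.range g', ⟨f'.orderIso.symm⟩, ⟨g'.orderIso.symm⟩, ?_⟩
  rintro _ ⟨x, rfl⟩ _ ⟨y, rfl⟩
  have h : c (f x) (g y) ≠ 1 := hfg x y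
  change c (f x) (g y) = 0
  omega
end
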